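/- Let φ : [0,∞] → [0,∞] be a convex non-decreasing function such that ∫_{δ*}^{∞} dτ/(τ·φ⁻¹(τ)) < ∞ for some δ* ∈ (φ(0), ∞). Then for every n ≥ 2 there exist R > 1 and a C¹ diffeomorphism f of the punctured unit ball 𝔹ⁿ \ {0} onto the spherical ring { x ∈ ℝⁿ : 1 < |x| < R } such that ∫_{𝔹ⁿ\{0}} φ(K_O(x,f)) dm(x) < ∞, but f cannot be extended by continuity to 0, i.e. the limit of f(x) as x → 0 does not exist. -/

import Mathlib

open MeasureTheory Metric Set Filter
open scoped ENNReal NNReal Topology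

/-- The generalized inverse `φ⁻¹(τ) = inf{ t : φ(t) ≥ τ }` of a non-decreasing
function `φ : [0,∞] → [0,∞]` (with `inf ∅ = ∞`). -/
noncomputable def genInv (φ : ℝ≥0∞ → ℝ≥0∞) (τ : ℝ≥0∞) : ℝ≥0∞ :=
  sInf {t : ℝ≥0∞ | τ ≤ φ t}

lemma hasFDerivAt_radial {E : Type*} [NormedAddCommGroup E] [InnerProductSpace ℝ E]
    {u : ℝ → ℝ} {u' : ℝ} {x : E} (hx : x ≠ 0) (hu : HasDerivAt u u' ‖x‖) :
    HasFDerivAt (fun y : E => u ‖y‖ • y)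
      (u ‖x‖ • ContinuousLinearMap.id ℝ E + (u' / ‖x‖) • (innerSL ℝ x).smulRight x) x := by
  have hnorm : ‖x‖ ≠ 0 := norm_ne_zero_iff.mpr hx
  have hsq := (hasStrictFDerivAt_norm_sq x).hasFDerivAt.sqrt (by positivity)
  simp only [Real.sqrt_sq (norm_nonneg _)] at hsq
  convert! (hu.comp_hasFDerivAt x hsq).smul (hasFDerivAt_id x) using 1
  ext v : 1
  simp only [add_apply, smul_apply,
    ContinuousLinearMap.smulRight_apply, ContinuousLinearMap.id_apply, smul_smul, smul_eq_mul,
    id, Function.comp]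
  congr 2
  simp
  field_simp

lemma det_smul_id_add_smulRight {E : Type*} [NormedAddCommGroup E] [InnerProductSpace ℝ E]
    [FiniteDimensional ℝ E] {a w : ℝ} (ha : a ≠ 0) (x : E) :
    (a • ContinuousLinearMap.id ℝ E + w • (innerSL ℝ x).smulRight x).det =
      a ^ Module.finrank ℝ E * (1 + w / a * ‖x‖ ^ 2) := by
  have h : ((a • ContinuousLinearMap.id ℝ E + w • (innerSL ℝ x).smulRight x : E →L[ℝ] E) :
      E →ₗ[ℝ] E) = a • LinearMap.transvection
        ((w / a) • ((innerSL ℝ x : E →L[ℝ] ℝ) : E →ₗ[ℝ] ℝ)) x := by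
    ext v
    simp [LinearMap.transvection.apply, smul_smul]
    congr 1
    field_simp
  rw [ContinuousLinearMap.det, h, LinearMap.det_smul, LinearMap.transvection.det]
  simp

lemma norm_smul_id_add_smulRight_le {E : Type*} [NormedAddCommGroup E] [InnerProductSpace ℝ E]
    {a w : ℝ} {x : E} (ha : 0 ≤ a) (hw : w ≤ 0) (haw : 0 ≤ a + w * ‖x‖ ^ 2) :
    ‖a • ContinuousLinearMap.id ℝ E + w • (innerSL ℝ x).smulRight x‖ ≤ a := by
  refine ContinuousLinearMap.opNorm_le_bound _ ha fun v => ?_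
  refine le_of_sq_le_sq ?_ (by positivity)
  have h : ‖a • v + (w * inner ℝ x v) • x‖ ^ 2 =
      (a * ‖v‖) ^ 2 + w * inner ℝ x v ^ 2 * (2 * a + w * ‖x‖ ^ 2) := by
    rw [norm_add_sq_real, norm_smul, norm_smul, inner_smul_left, inner_smul_right,
      real_inner_comm]
    simp only [Real.norm_eq_abs, mul_pow, sq_abs, RCLike.conj_to_real]
    ring
  have hle : w * inner ℝ x v ^ 2 * (2 * a + w * ‖x‖ ^ 2) ≤ 0 :=
    mul_nonpos_of_nonpos_of_nonneg (mul_nonpos_of_nonpos_of_nonneg hw (sq_nonneg _))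
      (by linarith)
  calc _ = ‖a • v + (w * inner ℝ x v) • x‖ ^ 2 := by simp [smul_smul]
    _ ≤ _ := by rw [h]; linarith

lemma contDiffOn_invFunOn {E : Type*} [NormedAddCommGroup E] [NormedSpace ℝ E]
    [FiniteDimensional ℝ E] {f : E → E} {U : Set E} (hU : IsOpen U) (hinj : InjOn f U)
    (hf : ContDiffOn ℝ 1 f U) (hdet : ∀ x ∈ U, (fderiv ℝ f x).det ≠ 0) :
    ContDiffOn ℝ 1 (Function.invFunOn f U) (f '' U) := by
  have := FiniteDimensional.complete ℝ E
  have : Nonempty E := ⟨0⟩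
  rintro _ ⟨x, hx, rfl⟩
  have hfx : ContDiffAt ℝ 1 f x := hf.contDiffAt (hU.mem_nhds hx)
  have hd : HasFDerivAt f
      ((fderiv ℝ f x).toContinuousLinearEquivOfDetNeZero (hdet x hx) : E →L[ℝ] E) x := by
    rw [ContinuousLinearMap.coe_toContinuousLinearEquivOfDetNeZero]
    exact (hfx.differentiableAt one_ne_zero).hasFDerivAt
  have hs := hfx.hasStrictFDerivAt' hd one_ne_zero
  refine ((hfx.to_localInverse hd one_ne_zero).congr_of_eventuallyEq ?_).contDiffWithinAt
  filter_upwards [hs.eventually_right_inverse,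
    hs.localInverse_tendsto.eventually (hU.mem_nhds hx)] with y hy hyU
  have hy' : f (hfx.localInverse hd one_ne_zero y) = y := hy
  have hyU' : hfx.localInverse hd one_ne_zero y ∈ U := hyU
  have hmem : ∃ z ∈ U, f z = y := ⟨_, hyU', hy'⟩
  exact hinj (Function.invFunOn_mem hmem) hyU' ((Function.invFunOn_eq hmem).trans hy'.symm)

lemma lintegral_inv_norm_ball_ne_top {E : Type*} [NormedAddCommGroup E] [NormedSpace ℝ E]
    [FiniteDimensional ℝ E] [MeasurableSpace E] [BorelSpace E] (μ : Measure E)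
    [μ.IsAddHaarMeasure] (hdim : 2 ≤ Module.finrank ℝ E) :
    ∫⁻ x in ball (0 : E) 1, ENNReal.ofReal (‖x‖⁻¹) ∂μ ≠ ∞ := by
  have : Nontrivial E := Module.nontrivial_of_finrank_pos (R := ℝ) (by omega)
  have hint : IntegrableOn (fun x : E => ‖x‖⁻¹) (ball 0 1) μ := by
    rw [integrableOn_fun_norm_addHaar μ (f := fun r => r⁻¹)]
    have hpow : IntegrableOn (fun r : ℝ => r ^ (Module.finrank ℝ E - 2)) (Ioo 0 1) :=
      ((continuous_pow _).continuousOn.integrableOn_Icc (a := 0) (b := 1)).mono_set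
        Ioo_subset_Icc_self
    refine hpow.congr_fun (fun r hr => ?_) measurableSet_Ioo
    obtain ⟨k, hk⟩ := Nat.exists_eq_add_of_le hdim
    have : r ≠ 0 := hr.1.ne'
    simp only [hk, smul_eq_mul]
    rw [show 2 + k - 2 = k by omega, show 2 + k - 1 = k + 1 by omega, pow_succ]
    field_simp
  exact (hint.lintegral_lt_top).ne

lemma apply_lt_of_lt_genInv {φ : ℝ≥0∞ → ℝ≥0∞} {s τ : ℝ≥0∞} (h : s < genInv φ τ) : φ s < τ :=
  lt_of_not_ge fun hs => h.not_ge (sInf_le hs)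

lemma genInv_mono (φ : ℝ≥0∞ → ℝ≥0∞) : Monotone (genInv φ) := fun _ _ h =>
  sInf_le_sInf fun _ ht => h.trans ht

lemma apply_one_ne_top_of_lintegral_genInv_ne_top {φ : ℝ≥0∞ → ℝ≥0∞} {δ : ℝ} (hδ : 0 < δ)
    (hconv : ∫⁻ τ in Ioi δ, (ENNReal.ofReal τ * genInv φ (ENNReal.ofReal τ))⁻¹ ≠ ∞) :
    φ 1 ≠ ∞ := by
  intro htop
  refine not_integrableOn_Ioi_inv (a := δ) ⟨by fun_prop, ?_⟩
  rw [hasFiniteIntegral_iff_enorm]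
  refine lt_of_le_of_lt (setLIntegral_mono' measurableSet_Ioi fun τ hτ => ?_) hconv.lt_top
  have hτ0 : 0 < τ := hδ.trans hτ
  rw [Real.enorm_eq_ofReal (inv_nonneg.2 hτ0.le), ENNReal.ofReal_inv_of_pos hτ0,
    ENNReal.inv_le_inv]
  calc _ ≤ ENNReal.ofReal τ * 1 := by
        gcongr
        exact sInf_le (by simp [htop])
    _ = _ := mul_one _

/-- A continuous density `p` on the half-line whose dilatation `1 / (t * p t)` is at least one
and grows slowly enough to be controlled by `φ`. -/
lemma exists_density {φ : ℝ≥0∞ → ℝ≥0∞} {δ : ℝ}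
    (hconv : ∫⁻ τ in Ioi δ, (ENNReal.ofReal τ * genInv φ (ENNReal.ofReal τ))⁻¹ ≠ ∞) :
    ∃ p : ℝ → ℝ, Continuous p ∧ (∀ t, 0 < p t) ∧ IntegrableOn p (Ioi 1) ∧
      ∀ t, 1 ≤ t → t * p t ≤ 1 ∧
        φ (ENNReal.ofReal (1 / (t * p t))) ≤ φ 1 + ENNReal.ofReal t := by
  set g : ℝ → ℝ≥0∞ := fun τ => min (genInv φ (ENNReal.ofReal τ)) (ENNReal.ofReal τ) with hg
  have hgtop : ∀ τ, g τ ≠ ∞ := fun τ => ((min_le_right _ _).trans_lt ENNReal.ofReal_lt_top).ne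
  have hgmono : Monotone g := fun a b hab =>
    min_le_min (genInv_mono φ (ENNReal.ofReal_le_ofReal hab)) (ENNReal.ofReal_le_ofReal hab)
  set h : ℝ → ℝ := fun τ => (g τ).toReal with hh
  have hmono : Monotone h := fun a b hab => ENNReal.toReal_mono (hgtop b) (hgmono hab)
  have hint : ∀ a b, IntervalIntegrable h volume a b := fun a b => hmono.intervalIntegrable
  set F : ℝ → ℝ := fun τ => ∫ s in (τ - 1)..τ, h s with hF
  have hFcont : Continuous F := by
    have hc := intervalIntegral.continuous_primitive hint 0
    have : F = fun τ => (∫ s in (0 : ℝ)..τ, h s) - ∫ s in (0 : ℝ)..(τ - 1), h s := by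
      funext τ
      exact (intervalIntegral.integral_interval_sub_left (hint _ _) (hint _ _)).symm
    rw [this]
    exact hc.sub (hc.comp (continuous_id.sub continuous_const))
  have hFle : ∀ τ, F τ ≤ h τ := fun τ => by
    have := intervalIntegral.integral_mono_on (by linarith : τ - 1 ≤ τ) (hint _ _)
      (intervalIntegrable_const (c := h τ)) (fun s hs => hmono hs.2)
    simpa using this
  have hleF : ∀ τ, h (τ - 1) ≤ F τ := fun τ => by
    have := intervalIntegral.integral_mono_on (by linarith : τ - 1 ≤ τ)
      (intervalIntegrable_const (c := h (τ - 1))) (hint _ _) (fun s hs => hmono hs.1)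
    simpa using this
  set k : ℝ → ℝ := fun τ => max 1 (F τ / 2) with hk
  have hkcont : Continuous k := continuous_const.max (hFcont.div_const 2)
  have hk1 : ∀ τ, 1 ≤ k τ := fun τ => le_max_left _ _
  have hφk : ∀ τ, φ (ENNReal.ofReal (k τ)) ≤ φ 1 + ENNReal.ofReal τ := fun τ => by
    rcases le_total (F τ / 2) 1 with hle | hle
    · simp [hk, max_eq_left hle]
    · refine le_add_of_le_right (apply_lt_of_lt_genInv ?_).le
      rw [hk]
      simp only [max_eq_right hle]
      refine lt_of_lt_of_le ((ENNReal.ofReal_lt_iff_lt_toReal (by linarith) (hgtop τ)).2 ?_)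
        (min_le_left _ _)
      have := hFle τ
      simp only [hh] at this
      linarith
  have hpos : ∀ t, 0 < max 1 t * k t := fun t =>
    mul_pos (lt_max_of_lt_left one_pos) (one_pos.trans_le (hk1 t))
  have hpcont : Continuous fun t => (max 1 t * k t)⁻¹ :=
    ((continuous_const.max continuous_id).mul hkcont).inv₀ fun t => (hpos t).ne'
  refine ⟨fun t => (max 1 t * k t)⁻¹, hpcont, fun t => inv_pos.2 (hpos t), ?_, fun t ht => ?_⟩
  · set M : ℝ := max δ 1 with hM
    have hM1 : 1 ≤ M := le_max_right _ _
    have htail : IntegrableOn (fun t => (max 1 t * k t)⁻¹) (Ioi (M + 1)) := by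
      refine ⟨hpcont.aestronglyMeasurable, ?_⟩
      rw [hasFiniteIntegral_iff_enorm]
      have hsq : ∫⁻ τ in Ioi M, ENNReal.ofReal (τ ^ (-2 : ℝ)) ≠ ∞ :=
        (integrableOn_Ioi_rpow_of_lt (by norm_num) (by linarith)).lintegral_lt_top.ne
      have hfin : ∫⁻ τ in Ioi M, (ENNReal.ofReal τ * g τ)⁻¹ ≠ ∞ := by
        refine ne_top_of_le_ne_top (ENNReal.add_ne_top.2
          ⟨ne_top_of_le_ne_top hconv (lintegral_mono_set (Ioi_subset_Ioi (le_max_left δ 1))),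
            hsq⟩) ?_
        rw [← lintegral_add_right _ (by fun_prop)]
        refine setLIntegral_mono' measurableSet_Ioi fun τ hτ => ?_
        have hτ0 : 0 < τ := by linarith [mem_Ioi.1 hτ]
        rcases min_choice (genInv φ (ENNReal.ofReal τ)) (ENNReal.ofReal τ) with hc | hc
        · simp only [hg, hc]
          exact le_self_add
        · simp only [hg, hc]
          refine le_add_of_le_right (le_of_eq ?_)
          rw [← ENNReal.ofReal_mul hτ0.le, ← ENNReal.ofReal_inv_of_pos (by positivity),
            Real.rpow_neg hτ0.le]
          norm_cast
          rw [sq]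
      have hshift : ∫⁻ τ in Ioi (M + 1), (ENNReal.ofReal (τ - 1) * g (τ - 1))⁻¹ =
          ∫⁻ τ in Ioi M, (ENNReal.ofReal τ * g τ)⁻¹ := by
        have hmp := measurePreserving_sub_right (volume : Measure ℝ) 1
        have := hmp.setLIntegral_comp_preimage_emb
          (MeasurableEquiv.subRight (1 : ℝ)).measurableEmbedding
          (fun τ => (ENNReal.ofReal τ * g τ)⁻¹) (Ioi M)
        simpa using this
      calc ∫⁻ τ in Ioi (M + 1), ‖(max 1 τ * k τ)⁻¹‖ₑ
          ≤ ∫⁻ τ in Ioi (M + 1), 2 * (ENNReal.ofReal (τ - 1) * g (τ - 1))⁻¹ := by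
            refine setLIntegral_mono' measurableSet_Ioi fun τ hτ => ?_
            have hτM : M + 1 < τ := hτ
            have hprod : ENNReal.ofReal (τ - 1) * g (τ - 1) / 2 ≤
                ENNReal.ofReal (max 1 τ * k τ) := by
              rw [← ENNReal.ofReal_toReal (hgtop (τ - 1)),
                ← ENNReal.ofReal_mul (by linarith), ← ENNReal.ofReal_ofNat 2,
                ← ENNReal.ofReal_div_of_pos two_pos, mul_div_assoc]
              refine ENNReal.ofReal_le_ofReal (mul_le_mul (le_max_of_le_right (by linarith)) ?_
                (by positivity) (by positivity))
              exact le_max_of_le_right (div_le_div_of_nonneg_right (hleF τ) two_pos.le)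
            rw [Real.enorm_eq_ofReal (inv_pos.2 (hpos τ)).le,
              ENNReal.ofReal_inv_of_pos (hpos τ)]
            refine (ENNReal.inv_le_inv.2 hprod).trans_eq ?_
            rw [ENNReal.inv_div (Or.inl ENNReal.ofNat_ne_top) (Or.inl two_ne_zero),
              div_eq_mul_inv]
        _ = 2 * ∫⁻ τ in Ioi M, (ENNReal.ofReal τ * g τ)⁻¹ := by
            rw [lintegral_const_mul' _ _ ENNReal.ofNat_ne_top, hshift]
        _ < ∞ := ENNReal.mul_lt_top ENNReal.ofNat_lt_top hfin.lt_top
    have hcomp : IntegrableOn (fun t => (max 1 t * k t)⁻¹) (Ioc 1 (M + 1)) :=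
      (hpcont.continuousOn.integrableOn_Icc).mono_set Ioc_subset_Icc_self
    rw [← Ioc_union_Ioi_eq_Ioi (by linarith : (1 : ℝ) ≤ M + 1)]
    exact hcomp.union htail
  · have ht0 : 0 < t := by linarith
    have hkt : 0 < k t := one_pos.trans_le (hk1 t)
    have heq : t * (max 1 t * k t)⁻¹ = (k t)⁻¹ := by
      rw [max_eq_right ht]
      field_simp
    rw [heq, one_div, inv_inv]
    exact ⟨inv_le_one_of_one_le₀ (hk1 t), hφk t⟩

/-- The primitive of a positive continuous integrable density increases strictly from `0` to its
total mass. -/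
lemma exists_primitive {p : ℝ → ℝ} (hp : Continuous p) (hpos : ∀ t, 0 < p t)
    (hint : IntegrableOn p (Ioi 1)) :
    ∃ (P : ℝ → ℝ) (A : ℝ), (∀ t, HasDerivAt P (p t) t) ∧ StrictMono P ∧ P 1 = 0 ∧
      (∀ t, P t < A) ∧ ∀ y, 0 < y → y < A → ∃ t, 1 < t ∧ P t = y := by
  have hderiv : ∀ t, HasDerivAt (fun t => ∫ s in (1 : ℝ)..t, p s) (p t) t := fun t =>
    (hp.integral_hasStrictDerivAt 1 t).hasDerivAt
  have hmono : StrictMono fun t => ∫ s in (1 : ℝ)..t, p s :=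
    strictMono_of_deriv_pos fun t => by rw [(hderiv t).deriv]; exact hpos t
  have htend := intervalIntegral_tendsto_integral_Ioi 1 hint tendsto_id
  have hone : ∫ s in (1 : ℝ)..1, p s = 0 := intervalIntegral.integral_same
  refine ⟨_, ∫ s in Ioi 1, p s, hderiv, hmono, hone, fun t => ?_, fun y hy0 hy => ?_⟩
  · exact (hmono (lt_add_one t)).trans_le (hmono.monotone.ge_of_tendsto htend _)
  · obtain ⟨T, hT1, hT⟩ := ((eventually_ge_atTop 1).and (htend.eventually (lt_mem_nhds hy))).exists
    have hcont : ContinuousOn (fun t => ∫ s in (1 : ℝ)..t, p s) (Icc 1 T) := fun t _ =>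
      (hderiv t).continuousAt.continuousWithinAt
    obtain ⟨t, ht, hty⟩ := intermediate_value_Icc hT1 hcont ⟨hone.le.trans hy0.le, le_of_lt hT⟩
    refine ⟨t, lt_of_le_of_ne ht.1 ?_, hty⟩
    rintro rfl
    exact hy0.ne (hone.symm.trans hty)

/-- Let `φ : [0,∞] → [0,∞]` be convex and non-decreasing with
`∫_{δ*}^∞ dτ/(τ φ⁻¹(τ)) < ∞` for some `δ* ∈ (φ(0),∞)`.  Then for every `n ≥ 2` there
are `R > 1` and a `C¹` diffeomorphism `f` of the punctured unit ball `𝔹ⁿ \ {0}` onto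
the ring `{1 < |x| < R}` (injective, with the stated image, `C¹` with everywhere
non-degenerate derivative, and with `C¹` inverse) such that
`∫_{𝔹ⁿ\{0}} φ(K_O(x,f)) dm(x) < ∞`, where `K_O(x,f) = ‖f′(x)‖ⁿ/|det f′(x)|`, but
`f` has no limit at `0`. -/
theorem stmt_12 (φ : ℝ≥0∞ → ℝ≥0∞) (hφmono : Monotone φ)
    (hφconv : ∀ (a : ℝ≥0), a ≤ 1 → ∀ t₁ t₂ : ℝ≥0∞,
      φ (a • t₁ + (1 - a) • t₂) ≤ a • φ t₁ + (1 - a) • φ t₂)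
    (δs : ℝ) (hδs : φ 0 < ENNReal.ofReal δs)
    (hconv : ∫⁻ τ in Set.Ioi δs,
      (ENNReal.ofReal τ * genInv φ (ENNReal.ofReal τ))⁻¹ ≠ ∞)
    (n : ℕ) (hn : 2 ≤ n) :
    ∃ R : ℝ, 1 < R ∧
      ∃ f : EuclideanSpace ℝ (Fin n) → EuclideanSpace ℝ (Fin n),
        Set.InjOn f (Metric.ball (0 : EuclideanSpace ℝ (Fin n)) 1 \ {0}) ∧
        f '' (Metric.ball (0 : EuclideanSpace ℝ (Fin n)) 1 \ {0}) =
          {y : EuclideanSpace ℝ (Fin n) | 1 < ‖y‖ ∧ ‖y‖ < R} ∧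
        ContDiffOn ℝ 1 f (Metric.ball (0 : EuclideanSpace ℝ (Fin n)) 1 \ {0}) ∧
        ContDiffOn ℝ 1
          (Function.invFunOn f (Metric.ball (0 : EuclideanSpace ℝ (Fin n)) 1 \ {0}))
          {y : EuclideanSpace ℝ (Fin n) | 1 < ‖y‖ ∧ ‖y‖ < R} ∧
        (∀ x ∈ Metric.ball (0 : EuclideanSpace ℝ (Fin n)) 1 \ {0},
          DifferentiableAt ℝ f x ∧ (fderiv ℝ f x).det ≠ 0) ∧
        (∫⁻ x in Metric.ball (0 : EuclideanSpace ℝ (Fin n)) 1 \ {0},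
          φ (ENNReal.ofReal (‖fderiv ℝ f x‖ ^ n / |(fderiv ℝ f x).det|))) ≠ ∞ ∧
        ¬ ∃ L : EuclideanSpace ℝ (Fin n),
            Tendsto f (𝓝[Metric.ball (0 : EuclideanSpace ℝ (Fin n)) 1 \ {0}] 0) (𝓝 L) := by
  have hδ : 0 < δs := ENNReal.ofReal_pos.1 (bot_le.trans_lt hδs)
  have hφ1 := apply_one_ne_top_of_lintegral_genInv_ne_top hδ hconv
  obtain ⟨p, hpcont, hppos, hpint, hpφ⟩ := exists_density hconv
  obtain ⟨P, A, hPd, hPmono, hP1, hPA, hPsurj⟩ := exists_primitive hpcont hppos hpint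
  have hA : 0 < A := hP1 ▸ hPA 1
  have hPC : ContDiff ℝ 1 P := by
    rw [contDiff_one_iff_deriv]
    exact ⟨fun t => (hPd t).differentiableAt, by
      rwa [show deriv P = p from funext fun t => (hPd t).deriv]⟩
  set u : ℝ → ℝ := fun r => Real.exp (A - P r⁻¹) / r with hu
  set f : EuclideanSpace ℝ (Fin n) → EuclideanSpace ℝ (Fin n) := fun x => u ‖x‖ • x with hf
  set U : Set (EuclideanSpace ℝ (Fin n)) := ball 0 1 \ {0} with hU
  have hUopen : IsOpen U := isOpen_ball.sdiff isClosed_singleton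
  have hmemU : ∀ x, x ∈ U ↔ 0 < ‖x‖ ∧ ‖x‖ < 1 := fun x => by
    simp [hU, and_comm]
  have hupos : ∀ r, 0 < r → 0 < u r := fun r hr => div_pos (Real.exp_pos _) hr
  have hnormf : ∀ x ∈ U, ‖f x‖ = Real.exp (A - P ‖x‖⁻¹) := fun x hx => by
    have h0 := ((hmemU x).1 hx).1
    rw [hf, norm_smul, Real.norm_of_nonneg (hupos _ h0).le, hu]
    field_simp
  have hinj : InjOn f U := fun x hx y hy hxy => by
    have h0 := ((hmemU x).1 hx).1
    have hnorm : ‖x‖ = ‖y‖ := by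
      have h := congrArg norm hxy
      rw [hnormf x hx, hnormf y hy] at h
      exact inv_injective (hPmono.injective (sub_right_injective (Real.exp_injective h)))
    simp only [hf, ← hnorm] at hxy
    exact smul_right_injective _ (hupos _ h0).ne' hxy
  have himage : f '' U = {y | 1 < ‖y‖ ∧ ‖y‖ < Real.exp A} := by
    ext y
    constructor
    · rintro ⟨x, hx, rfl⟩
      rw [mem_ofPred_eq, hnormf x hx]
      have h01 := (hmemU x).1 hx
      have hPx : 0 < P ‖x‖⁻¹ := hP1 ▸ hPmono ((one_lt_inv₀ h01.1).2 h01.2)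
      exact ⟨Real.one_lt_exp_iff.2 (sub_pos.2 (hPA _)), Real.exp_lt_exp.2 (by linarith)⟩
    · rintro ⟨hy1, hyA⟩
      have hy0 : 0 < ‖y‖ := one_pos.trans hy1
      obtain ⟨t, ht, hPt⟩ := hPsurj (A - Real.log ‖y‖)
        (sub_pos.2 ((Real.log_lt_iff_lt_exp hy0).2 hyA))
        (sub_lt_self _ (Real.log_pos hy1))
      have ht0 : 0 < t := one_pos.trans ht
      have hnx : ‖(t⁻¹ / ‖y‖) • y‖ = t⁻¹ := by
        rw [norm_smul, Real.norm_of_nonneg (by positivity)]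
        field_simp
      refine ⟨(t⁻¹ / ‖y‖) • y, (hmemU _).2 ?_, ?_⟩
      · rw [hnx]
        exact ⟨inv_pos.2 ht0, inv_lt_one_of_one_lt₀ ht⟩
      · simp only [hf, hnx, hu, inv_inv, hPt, sub_sub_cancel, Real.exp_log hy0, smul_smul]
        rw [show ‖y‖ / t⁻¹ * (t⁻¹ / ‖y‖) = 1 by field_simp, one_smul]
  have hcd : ContDiffOn ℝ 1 f U := fun x hx => by
    have h0 := ((hmemU x).1 hx).1
    have hn : ContDiffAt ℝ 1 (fun y : EuclideanSpace ℝ (Fin n) => ‖y‖) x :=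
      contDiffAt_norm ℝ (norm_pos_iff.1 h0)
    have hPn := hPC.contDiffAt.comp x (hn.inv h0.ne')
    exact ((((contDiffAt_const.sub hPn).exp).div hn h0.ne').smul contDiffAt_id).contDiffWithinAt
  have hfd : ∀ x ∈ U, ∃ w, HasFDerivAt f
      (u ‖x‖ • ContinuousLinearMap.id ℝ _ + w • (innerSL ℝ x).smulRight x) x ∧
      w * ‖x‖ ^ 2 = u ‖x‖ * (‖x‖⁻¹ * p ‖x‖⁻¹ - 1) := fun x hx => by
    have h0 := ((hmemU x).1 hx).1
    have hud := ((((hPd ‖x‖⁻¹).comp ‖x‖ (hasDerivAt_inv h0.ne')).const_sub A).exp).div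
      (hasDerivAt_id ‖x‖) h0.ne'
    refine ⟨_, hasFDerivAt_radial (norm_pos_iff.1 h0) hud, ?_⟩
    simp only [hu, Function.comp, id]
    field_simp
  have hdil : ∀ x ∈ U, (fderiv ℝ f x).det ≠ 0 ∧
      ‖fderiv ℝ f x‖ ^ n / |(fderiv ℝ f x).det| ≤ 1 / (‖x‖⁻¹ * p ‖x‖⁻¹) := fun x hx => by
    obtain ⟨w, hw, hwu⟩ := hfd x hx
    obtain ⟨h0, h1⟩ := (hmemU x).1 hx
    have hux := hupos _ h0
    have hq : 0 < ‖x‖⁻¹ * p ‖x‖⁻¹ := mul_pos (inv_pos.2 h0) (hppos _)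
    have hq1 := (hpφ ‖x‖⁻¹ ((one_le_inv₀ h0).2 h1.le)).1
    have hdet : (fderiv ℝ f x).det = u ‖x‖ ^ n * (‖x‖⁻¹ * p ‖x‖⁻¹) := by
      rw [hw.fderiv, det_smul_id_add_smulRight hux.ne', finrank_euclideanSpace_fin,
        div_mul_eq_mul_div, hwu, mul_div_cancel_left₀ _ hux.ne', add_sub_cancel]
    have hle : ‖fderiv ℝ f x‖ ≤ u ‖x‖ := by
      rw [hw.fderiv]
      refine norm_smul_id_add_smulRight_le hux.le ?_ ?_
      · refine nonpos_of_mul_nonpos_left (hwu.trans_le ?_) (pow_pos h0 2)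
        exact mul_nonpos_of_nonneg_of_nonpos hux.le (by linarith)
      · rw [hwu]
        nlinarith [mul_pos hux hq]
    have hdetpos : 0 < u ‖x‖ ^ n * (‖x‖⁻¹ * p ‖x‖⁻¹) := mul_pos (pow_pos hux n) hq
    refine ⟨hdet ▸ hdetpos.ne', ?_⟩
    rw [hdet, abs_of_pos hdetpos]
    calc _ ≤ u ‖x‖ ^ n / (u ‖x‖ ^ n * (‖x‖⁻¹ * p ‖x‖⁻¹)) := by gcongr
      _ = _ := by rw [div_mul_eq_div_div, div_self (pow_pos hux n).ne']
  refine ⟨Real.exp A, Real.one_lt_exp_iff.2 hA, f, hinj, himage, hcd, ?_, fun x hx => ?_, ?_, ?_⟩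
  · rw [← himage]
    exact contDiffOn_invFunOn hUopen hinj hcd fun x hx => (hdil x hx).1
  · obtain ⟨w, hw, -⟩ := hfd x hx
    exact ⟨hw.differentiableAt, (hdil x hx).1⟩
  · have hfin : ∫⁻ x in ball (0 : EuclideanSpace ℝ (Fin n)) 1,
        (φ 1 + ENNReal.ofReal ‖x‖⁻¹) ≠ ∞ := by
      rw [lintegral_add_left measurable_const, setLIntegral_const]
      exact ENNReal.add_ne_top.2 ⟨ENNReal.mul_ne_top hφ1 measure_ball_lt_top.ne,
        lintegral_inv_norm_ball_ne_top volume (by simpa using hn)⟩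
    refine ne_top_of_le_ne_top hfin
      ((setLIntegral_mono' hUopen.measurableSet fun x hx => ?_).trans
        (lintegral_mono_set sdiff_subset))
    obtain ⟨h0, h1⟩ := (hmemU x).1 hx
    exact (hφmono (ENNReal.ofReal_le_ofReal (hdil x hx).2)).trans
      (hpφ ‖x‖⁻¹ ((one_le_inv₀ h0).2 h1.le)).2
  · rintro ⟨L, hL⟩
    have : Nonempty (Fin n) := ⟨⟨0, by omega⟩⟩
    have hfilter : 𝓝[U] (0 : EuclideanSpace ℝ (Fin n)) = 𝓝[≠] 0 := by
      rw [hU, sdiff_eq, inter_comm]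
      exact nhdsWithin_inter_of_mem' (mem_nhdsWithin_of_mem_nhds (ball_mem_nhds 0 one_pos))
    have hneBot : (𝓝[U] (0 : EuclideanSpace ℝ (Fin n))).NeBot := hfilter ▸ inferInstance
    have hneg : Tendsto (fun x : EuclideanSpace ℝ (Fin n) => -x) (𝓝[U] 0) (𝓝[U] 0) := by
      refine tendsto_nhdsWithin_iff.2 ⟨?_, ?_⟩
      · simpa using (tendsto_neg (0 : EuclideanSpace ℝ (Fin n))).mono_left nhdsWithin_le_nhds
      · filter_upwards [self_mem_nhdsWithin] with x hx
        rw [hmemU, norm_neg]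
        exact (hmemU x).1 hx
    have hL' : Tendsto f (𝓝[U] 0) (𝓝 (-L)) := by
      refine ((hL.comp hneg).neg).congr fun x => ?_
      simp [hf]
    have : IsAddTorsionFree (EuclideanSpace ℝ (Fin n)) := .of_isTorsionFree ℝ _
    have hL0 : L = 0 := self_eq_neg.1 (tendsto_nhds_unique hL hL')
    have hge : 1 ≤ ‖L‖ := by
      refine ge_of_tendsto hL.norm ?_
      filter_upwards [self_mem_nhdsWithin] with x hx
      exact (himage.subset (mem_image_of_mem f hx)).1.le
    rw [hL0, norm_zero] at hge
    linarith
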